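/- arXiv:1501.07480 — 7 statements merged into one kernel-verified Lean document; each statement's English description precedes it below -/
import Mathlib

section
/- Let U: (0,∞) → ℝ be strictly increasing, strictly concave and differentiable with lim_{x→∞} U(x) = +∞. Then the asymptotic elasticity AE(U) := limsup_{x→∞} x U'(x)/U(x) satisfies 0 ≤ AE(U) ≤ 1. -/
/-- If `U` is strictly increasing, strictly concave, differentiable on `(0, infinity)` and
tends to `+infinity` at `+infinity`, then the asymptotic elasticity
`AE U = limsup (x * U' x / U x)` lies in `[0, 1]`. -/
theorem asymptotic_elasticity_mem_unitInterval (U U' : ℝ → ℝ)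
    (hmono : StrictMonoOn U (Set.Ioi 0))
    (hconc : StrictConcaveOn ℝ (Set.Ioi 0) U)
    (hderiv : ∀ x ∈ Set.Ioi (0:ℝ), HasDerivAt U (U' x) x)
    (hlim : Filter.Tendsto U Filter.atTop Filter.atTop) :
    0 ≤ Filter.limsup (fun x : ℝ => ((x * U' x / U x : ℝ) : EReal)) Filter.atTop ∧
    Filter.limsup (fun x : ℝ => ((x * U' x / U x : ℝ) : EReal)) Filter.atTop ≤ 1 := by
  have hupper : ∀ x y, 0 < x → x < y → U y - U x ≤ U' x * (y - x) := fun x y hx hxy => by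
    have h := hconc.concaveOn.slope_le_of_hasDerivAt (Set.mem_Ioi.2 hx)
      (Set.mem_Ioi.2 (hx.trans hxy)) hxy (hderiv x hx)
    rwa [slope_def_field, div_le_iff₀ (sub_pos.2 hxy)] at h
  have hlower : ∀ x y, 0 < x → x < y → U' y * (y - x) ≤ U y - U x := fun x y hx hxy => by
    have h := hconc.concaveOn.le_slope_of_hasDerivAt (Set.mem_Ioi.2 hx)
      (Set.mem_Ioi.2 (hx.trans hxy)) hxy (hderiv y (hx.trans hxy))
    rwa [slope_def_field, le_div_iff₀ (sub_pos.2 hxy)] at h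
  constructor
  · refine Filter.le_limsup_of_frequently_le' (Filter.Eventually.frequently ?_)
    filter_upwards [Filter.eventually_gt_atTop 0, hlim.eventually_gt_atTop 0] with x hx hU
    have hstep := hupper x (x + 1) hx (by linarith)
    have hlt := hmono (Set.mem_Ioi.2 hx) (Set.mem_Ioi.2 (by linarith : 0 < x + 1)) (by linarith)
    have hU' : 0 ≤ U' x := by linarith
    exact EReal.coe_nonneg.2 (by positivity)
  · have hbound : Filter.Tendsto (fun x => ((1 + (U' 1 - U 1) / U x : ℝ) : EReal))
        Filter.atTop (nhds 1) := by
      have h : Filter.Tendsto (fun x => 1 + (U' 1 - U 1) / U x) Filter.atTop (nhds (1 + 0)) :=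
        (hlim.const_div_atTop _).const_add 1
      rw [add_zero] at h
      exact (continuous_coe_real_ereal.tendsto 1).comp h
    rw [← hbound.limsup_eq]
    refine Filter.limsup_le_limsup ?_
    filter_upwards [Filter.eventually_gt_atTop 1, hlim.eventually_gt_atTop 0] with x hx hU
    have hx' := hlower 1 x one_pos hx
    have hanti : U' x ≤ U' 1 :=
      le_of_mul_le_mul_right (hx'.trans (hupper 1 x one_pos hx)) (sub_pos.2 hx)
    refine EReal.coe_le_coe_iff.2 ?_
    rw [div_le_iff₀ hU, add_mul, div_mul_cancel₀ _ hU.ne']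
    linarith
end

section
/- Let U: (0,∞) → ℝ be strictly increasing, strictly concave and differentiable with lim_{x→∞} U(x) = c for some c ∈ (0,∞). Then x U'(x)/U(x) → 0 as x → ∞; in particular the asymptotic elasticity AE(U) := limsup_{x→∞} x U'(x)/U(x) equals 0. -/
/-- For a concave function, the derivative at `x` is at most the slope of the chord over
`[x / 2, x]`. -/
theorem ConcaveOn.mul_deriv_le_two_mul_sub_half {U : ℝ → ℝ} {d x : ℝ}
    (hconc : ConcaveOn ℝ (Set.Ioi 0) U) (hx : 0 < x) (hd : HasDerivAt U d x) :
    x * d ≤ 2 * (U x - U (x / 2)) := by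
  have h := hconc.le_slope_of_hasDerivAt (Set.mem_Ioi.2 (half_pos hx)) (Set.mem_Ioi.2 hx)
    (half_lt_self hx) hd
  rw [slope_def_field, le_div_iff₀ (by linarith)] at h
  linarith

/-- If `U` is strictly increasing, strictly concave, differentiable on `(0, infinity)` and
tends to a finite positive limit `c` at `+infinity`, then `x * U' x / U x → 0`, so the
asymptotic elasticity of `U` equals `0`. -/
theorem asymptotic_elasticity_zero_of_finite_limit (U U' : ℝ → ℝ)
    (hmono : StrictMonoOn U (Set.Ioi 0))
    (hconc : StrictConcaveOn ℝ (Set.Ioi 0) U)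
    (hderiv : ∀ x ∈ Set.Ioi (0:ℝ), HasDerivAt U (U' x) x)
    (c : ℝ) (hc : 0 < c) (hlim : Filter.Tendsto U Filter.atTop (nhds c)) :
    Filter.Tendsto (fun x : ℝ => x * U' x / U x) Filter.atTop (nhds 0) ∧
    Filter.limsup (fun x : ℝ => ((x * U' x / U x : ℝ) : EReal)) Filter.atTop = 0 := by
  have hnum : Filter.Tendsto (fun x : ℝ => x * U' x) Filter.atTop (nhds 0) := by
    have hhalf : Filter.Tendsto (fun x : ℝ => U (x / 2)) Filter.atTop (nhds c) :=
      hlim.comp (Filter.tendsto_id.atTop_div_const two_pos)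
    have hbound : Filter.Tendsto (fun x : ℝ => 2 * (U x - U (x / 2))) Filter.atTop (nhds 0) := by
      simpa using (hlim.sub hhalf).const_mul 2
    refine tendsto_of_tendsto_of_tendsto_of_le_of_le' tendsto_const_nhds hbound ?_ ?_
    · filter_upwards [Filter.eventually_gt_atTop 0] with x hx
      have hx1 : x + 1 ∈ Set.Ioi (0 : ℝ) := Set.mem_Ioi.2 (by linarith)
      have h := hconc.concaveOn.slope_le_of_hasDerivAt (Set.mem_Ioi.2 hx) hx1
        (lt_add_one x) (hderiv x hx)
      rw [slope_def_field, add_sub_cancel_left, div_one] at h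
      have h' := hmono (Set.mem_Ioi.2 hx) hx1 (lt_add_one x)
      exact mul_nonneg hx.le (by linarith)
    · filter_upwards [Filter.eventually_gt_atTop 0] with x hx
      exact hconc.concaveOn.mul_deriv_le_two_mul_sub_half hx (hderiv x hx)
  have hmain : Filter.Tendsto (fun x : ℝ => x * U' x / U x) Filter.atTop (nhds 0) := by
    rw [← zero_div c]
    exact hnum.div hlim hc.ne'
  exact ⟨hmain, (EReal.tendsto_coe.2 hmain).limsup_eq⟩
end

section
/- Let U: (0,∞) → ℝ be strictly increasing, strictly concave and differentiable, let c₁ ∈ ℝ and c₂ > 0, and define Ũ(x) := c₁ + c₂ U(x). If lim_{x→∞} U(x) > 0 and lim_{x→∞} Ũ(x) > 0 (either limit may be +∞), then limsup_{x→∞} x Ũ'(x)/Ũ(x) = limsup_{x→∞} x U'(x)/U(x), and this common value lies in [0,1]. -/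
open Filter Set Topology

/-- Real functions whose difference tends to zero have the same upper limit in `EReal`. -/
theorem limsup_coe_ereal_eq_of_tendsto_sub {α : Type*} {F : Filter α} [F.NeBot] {f g : α → ℝ}
    (h : Tendsto (fun x => g x - f x) F (𝓝 0)) :
    limsup (fun x => (g x : EReal)) F = limsup (fun x => (f x : EReal)) F := by
  have key : ∀ f g : α → ℝ, Tendsto (fun x => g x - f x) F (𝓝 0) →
      limsup (fun x => (g x : EReal)) F ≤ limsup (fun x => (f x : EReal)) F := by
    intro f g h
    have hl : limsup (fun x => ((g x - f x : ℝ) : EReal)) F = 0 :=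
      (EReal.tendsto_coe.2 h).limsup_eq
    have hadd := EReal.limsup_add_le (f := F) (u := fun x => (f x : EReal))
      (v := fun x => ((g x - f x : ℝ) : EReal)) (.inr (by rw [hl]; simp)) (.inr (by rw [hl]; simp))
    rw [hl, add_zero] at hadd
    convert hadd using 2
    ext x
    rw [Pi.add_apply, ← EReal.coe_add, add_sub_cancel]
  exact le_antisymm (key f g h) (key g f (by simpa using h.neg))

section Elasticity

variable {U U' : ℝ → ℝ}

theorem ConcaveOn.hasDerivAt_mul_sub_le (hconc : ConcaveOn ℝ (Ioi 0) U) {x y u : ℝ}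
    (hy : 0 < y) (hyx : y < x) (hu : HasDerivAt U u x) : u * (x - y) ≤ U x - U y := by
  have h := hconc.le_slope_of_hasDerivAt hy (hy.trans hyx) hyx hu
  rwa [slope_def_field, le_div_iff₀ (sub_pos.2 hyx)] at h

theorem MonotoneOn.hasDerivAt_nonneg_of_pos (hmono : MonotoneOn U (Ioi 0)) {x u : ℝ}
    (hx : 0 < x) (hu : HasDerivAt U u x) : 0 ≤ u := by
  have h := hmono.derivWithin_nonneg (x := x)
  rwa [derivWithin_of_isOpen isOpen_Ioi hx, hu.deriv] at h

/-- If a concave increasing function has a finite limit at infinity, then `x * U' x → 0`. -/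
theorem ConcaveOn.tendsto_mul_hasDerivAt_zero (hmono : MonotoneOn U (Ioi 0))
    (hconc : ConcaveOn ℝ (Ioi 0) U) (hderiv : ∀ x ∈ Ioi (0 : ℝ), HasDerivAt U (U' x) x)
    {L : ℝ} (hL : Tendsto U atTop (𝓝 L)) : Tendsto (fun x => x * U' x) atTop (𝓝 0) := by
  have hhalf : Tendsto (fun x : ℝ => U (x / 2)) atTop (𝓝 L) :=
    hL.comp (tendsto_id.atTop_div_const two_pos)
  have hub : Tendsto (fun x => 2 * (U x - U (x / 2))) atTop (𝓝 0) := by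
    simpa using (hL.sub hhalf).const_mul 2
  refine tendsto_of_tendsto_of_tendsto_of_le_of_le' tendsto_const_nhds hub ?_ ?_
  · filter_upwards [eventually_gt_atTop 0] with x hx
    exact mul_nonneg hx.le (hmono.hasDerivAt_nonneg_of_pos hx (hderiv x hx))
  · filter_upwards [eventually_gt_atTop 0] with x hx
    linarith [hconc.hasDerivAt_mul_sub_le (half_pos hx) (half_lt_self hx) (hderiv x hx)]

/-- The tangent inequality bounds `x * U' x` by `U x` up to a constant. -/
theorem ConcaveOn.mul_hasDerivAt_le (hconc : ConcaveOn ℝ (Ioi 0) U)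
    (hderiv : ∀ x ∈ Ioi (0 : ℝ), HasDerivAt U (U' x) x) {x : ℝ} (hx : 1 < x) :
    x * U' x ≤ U x + (U' 1 - U 1) := by
  have hx0 : x ∈ Ioi (0 : ℝ) := one_pos.trans hx
  have hone : (1 : ℝ) ∈ Ioi (0 : ℝ) := mem_Ioi.2 one_pos
  have hanti : U' x ≤ U' 1 :=
    (hconc.le_slope_of_hasDerivAt hone hx0 hx (hderiv x hx0)).trans
      (hconc.slope_le_of_hasDerivAt hone hx0 hx (hderiv 1 hone))
  linarith [hconc.hasDerivAt_mul_sub_le one_pos hx (hderiv x hx0)]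

end Elasticity

/-- The asymptotic elasticity is invariant under affine transformations with positive
leading coefficient, and the common value lies in `[0, 1]`, provided both functions have a
positive (possibly infinite) limit at `+infinity`. -/
theorem asymptotic_elasticity_affine_invariant (U U' : ℝ → ℝ)
    (hmono : StrictMonoOn U (Set.Ioi 0))
    (hconc : StrictConcaveOn ℝ (Set.Ioi 0) U)
    (hderiv : ∀ x ∈ Set.Ioi (0:ℝ), HasDerivAt U (U' x) x)
    (c₁ c₂ : ℝ) (hc₂ : 0 < c₂)
    (hUlim : ∃ l : EReal, 0 < l ∧
      Filter.Tendsto (fun x : ℝ => ((U x : ℝ) : EReal)) Filter.atTop (nhds l))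
    (htUlim : ∃ l : EReal, 0 < l ∧
      Filter.Tendsto (fun x : ℝ => ((c₁ + c₂ * U x : ℝ) : EReal)) Filter.atTop (nhds l)) :
    Filter.limsup (fun x : ℝ => ((x * (c₂ * U' x) / (c₁ + c₂ * U x) : ℝ) : EReal))
        Filter.atTop
      = Filter.limsup (fun x : ℝ => ((x * U' x / U x : ℝ) : EReal)) Filter.atTop ∧
    0 ≤ Filter.limsup (fun x : ℝ => ((x * U' x / U x : ℝ) : EReal)) Filter.atTop ∧
    Filter.limsup (fun x : ℝ => ((x * U' x / U x : ℝ) : EReal)) Filter.atTop ≤ 1 := by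
  obtain ⟨l, hl, hU⟩ := hUlim
  obtain ⟨m, hm, hV⟩ := htUlim
  induction l with
  | bot => simp at hl
  | coe L =>
    rw [EReal.tendsto_coe] at hU
    have hL : 0 < L := EReal.coe_pos.1 hl
    have hV' : Tendsto (fun x => c₁ + c₂ * U x) atTop (𝓝 (c₁ + c₂ * L)) :=
      (hU.const_mul c₂).const_add c₁
    have hM : 0 < c₁ + c₂ * L := by
      rw [tendsto_nhds_unique hV (EReal.tendsto_coe.2 hV')] at hm
      exact EReal.coe_pos.1 hm
    have hnum := hconc.concaveOn.tendsto_mul_hasDerivAt_zero hmono.monotoneOn hderiv hU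
    have hf : Tendsto (fun x => x * U' x / U x) atTop (𝓝 0) := by
      simpa [Pi.div_def] using hnum.div hU hL.ne'
    have hg : Tendsto (fun x => x * (c₂ * U' x) / (c₁ + c₂ * U x)) atTop (𝓝 0) := by
      simpa [Pi.div_def, mul_left_comm] using (hnum.const_mul c₂).div hV' hM.ne'
    rw [(EReal.tendsto_coe.2 hf).limsup_eq, (EReal.tendsto_coe.2 hg).limsup_eq]
    simp
  | top =>
    rw [EReal.tendsto_coe_nhds_top_iff] at hU
    have hV' : Tendsto (fun x => c₁ + c₂ * U x) atTop atTop :=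
      tendsto_atTop_add_const_left _ _ (hU.const_mul_atTop hc₂)
    have hnonneg : ∀ᶠ x in atTop, 0 ≤ x * U' x / U x := by
      filter_upwards [eventually_gt_atTop 0, hU.eventually_gt_atTop 0] with x hx hUx
      exact div_nonneg (mul_nonneg hx.le
        (hmono.monotoneOn.hasDerivAt_nonneg_of_pos hx (hderiv x hx))) hUx.le
    have hbound : Tendsto (fun x => 1 + (U' 1 - U 1) / U x) atTop (𝓝 1) := by
      simpa using (hU.const_div_atTop (U' 1 - U 1)).const_add 1
    have hle : ∀ᶠ x in atTop, x * U' x / U x ≤ 1 + (U' 1 - U 1) / U x := by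
      filter_upwards [eventually_gt_atTop 1, hU.eventually_gt_atTop 0] with x hx hUx
      rw [div_le_iff₀ hUx, add_mul, one_mul, div_mul_cancel₀ _ hUx.ne']
      exact hconc.concaveOn.mul_hasDerivAt_le hderiv hx
    refine ⟨limsup_coe_ereal_eq_of_tendsto_sub ?_, ?_, ?_⟩
    · have hbdd : IsBoundedUnder (· ≤ ·) atTop (norm ∘ fun x => x * U' x / U x) := by
        refine isBoundedUnder_of_eventually_le (a := 2) ?_
        filter_upwards [hnonneg, hle, hbound.eventually_lt_const one_lt_two] with x h0 h1 h2
        rw [Function.comp_apply, Real.norm_of_nonneg h0]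
        exact h1.trans h2.le
      refine ((hV'.const_div_atTop (-c₁)).zero_mul_isBoundedUnder_le hbdd).congr' ?_
      filter_upwards [hU.eventually_gt_atTop 0, hV'.eventually_gt_atTop 0] with x hUx hVx
      field_simp
      ring
    · refine le_limsup_of_frequently_le (Eventually.frequently ?_)
      filter_upwards [hnonneg] with x hx using EReal.coe_nonneg.2 hx
    · calc limsup (fun x : ℝ => ((x * U' x / U x : ℝ) : EReal)) atTop
          ≤ limsup (fun x : ℝ => ((1 + (U' 1 - U 1) / U x : ℝ) : EReal)) atTop := by
            refine limsup_le_limsup ?_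
            filter_upwards [hle] with x hx using EReal.coe_le_coe hx
        _ = 1 := (EReal.tendsto_coe.2 hbound).limsup_eq
end

section
/- Let U be a utility function with lim_{x→∞} U(x) < +∞, let L be a loss function bounded below (i.e. lim_{x→−∞} L(x) > −∞), and let λ ≥ 0. Define W_λ(x) := U(x) − λ L(−x), so that lim_{x→∞} W_λ(x) < +∞. Then the asymptotic elasticity of W_λ is strictly less than one: limsup_{x→∞} x W_λ'(x)/W_λ(x) < 1 (the limsup taken in the extended reals). -/
structure IsUtility (U U' : ℝ → ℝ) : Prop where
  strictMono : StrictMonoOn U (Set.Ioi 0)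
  strictConcave : StrictConcaveOn ℝ (Set.Ioi 0) U
  hasDeriv : ∀ x ∈ Set.Ioi (0:ℝ), HasDerivAt U (U' x) x
  contDeriv : ContinuousOn U' (Set.Ioi 0)
  inada_top : Filter.Tendsto U' Filter.atTop (nhds 0)
  inada_zero : Filter.Tendsto U' (nhdsWithin 0 (Set.Ioi 0)) Filter.atTop

structure IsLoss (L L' : ℝ → ℝ) : Prop where
  strictMono : StrictMonoOn L (Set.Iio 0)
  strictConvex : StrictConvexOn ℝ (Set.Iio 0) L
  hasDeriv : ∀ x ∈ Set.Iio (0:ℝ), HasDerivAt L (L' x) x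
  contDeriv : ContinuousOn L' (Set.Iio 0)
  derivLimAtZero : ∃ c : ℝ, Filter.Tendsto L' (nhdsWithin 0 (Set.Iio 0)) (nhds c)
  derivLimAtBot : Filter.Tendsto L' Filter.atBot (nhds 0)

open Filter Topology Set in
/-- A concave increasing function on `(0, ∞)` with a finite limit at infinity satisfies
`x * f' x / f x ≤ 1 / 2` for all large `x`. -/
theorem ConcaveOn.eventually_elasticity_le_half {f f' : ℝ → ℝ} {c : ℝ}
    (hconc : ConcaveOn ℝ (Ioi 0) f) (hmono : StrictMonoOn f (Ioi 0))
    (hderiv : ∀ x ∈ Ioi (0 : ℝ), HasDerivAt f (f' x) x) (hlim : Tendsto f atTop (𝓝 c)) :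
    ∀ᶠ x in atTop, x * f' x / f x ≤ 1 / 2 := by
  have hnonneg : ∀ x > 0, 0 ≤ f' x := fun x hx => by
    have h1 : f (x + 1) > f x := hmono hx (by simp only [mem_Ioi]; linarith) (by linarith)
    have h2 := hconc.slope_le_of_hasDerivAt (x := x) (y := x + 1) hx
      (by simp only [mem_Ioi]; linarith) (by linarith) (hderiv x hx)
    rw [slope_def_field, add_sub_cancel_left, div_one] at h2
    linarith
  have hupper : ∀ x > 0, x * f' x ≤ 2 * (f x - f (x / 2)) := fun x hx => by
    have h2 := hconc.le_slope_of_hasDerivAt (x := x / 2) (y := x)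
      (by simp only [mem_Ioi]; linarith) hx (by linarith) (hderiv x hx)
    rw [slope_def_field, le_div_iff₀ (by linarith)] at h2
    linarith
  have hhalf : Tendsto (fun x : ℝ => f (x / 2)) atTop (𝓝 c) :=
    hlim.comp (tendsto_id.atTop_div_const two_pos)
  have hnum : Tendsto (fun x => x * f' x) atTop (𝓝 0) := by
    have h0 : Tendsto (fun x => 2 * (f x - f (x / 2))) atTop (𝓝 0) := by
      simpa using (hlim.sub hhalf).const_mul 2
    refine tendsto_of_tendsto_of_tendsto_of_le_of_le' tendsto_const_nhds h0 ?_ ?_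
    · filter_upwards [eventually_gt_atTop 0] with x hx using mul_nonneg hx.le (hnonneg x hx)
    · filter_upwards [eventually_gt_atTop 0] with x hx using hupper x hx
  by_cases hc : c = 0
  · filter_upwards [eventually_gt_atTop 0] with x hx
    have hlt : f x < f (x + 1) := hmono hx (by simp only [mem_Ioi]; linarith) (by linarith)
    have hle : f (x + 1) ≤ c := by
      refine ge_of_tendsto hlim ?_
      filter_upwards [eventually_ge_atTop (x + 1)] with y hy
      exact hmono.monotoneOn (by simp only [mem_Ioi]; linarith)
        (by simp only [mem_Ioi]; linarith) hy
    have := div_nonpos_of_nonneg_of_nonpos (mul_nonneg hx.le (hnonneg x hx))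
      (by linarith : f x ≤ 0)
    linarith
  · have h := hnum.div hlim hc
    rw [zero_div] at h
    exact h.eventually_le_const (by norm_num)

/-- If `U` has a finite limit at `+infinity` and `L` is bounded below (finite limit at
`-infinity`), then `W_lam` has a finite limit at `+infinity` and its asymptotic elasticity
is strictly less than one. -/
theorem ae_W_lt_one_of_bounded (U U' L L' : ℝ → ℝ) (hU : IsUtility U U') (hL : IsLoss L L')
    (cU : ℝ) (hUlim : Filter.Tendsto U Filter.atTop (nhds cU))
    (dL : ℝ) (hLlim : Filter.Tendsto L Filter.atBot (nhds dL))
    (lam : ℝ) (hlam : 0 ≤ lam) :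
    (∃ c : ℝ, Filter.Tendsto (fun x => U x - lam * L (-x)) Filter.atTop (nhds c)) ∧
    Filter.limsup
        (fun x : ℝ => ((x * (U' x + lam * L' (-x)) / (U x - lam * L (-x)) : ℝ) : EReal))
        Filter.atTop < 1 := by
  have hlim : Filter.Tendsto (fun x => U x - lam * L (-x)) Filter.atTop
      (nhds (cU - lam * dL)) :=
    hUlim.sub ((hLlim.comp Filter.tendsto_neg_atTop_atBot).const_mul lam)
  refine ⟨⟨_, hlim⟩, ?_⟩
  have hneg : ∀ {x : ℝ}, x ∈ Set.Ioi (0 : ℝ) → -x ∈ Set.Iio (0 : ℝ) := fun hx => by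
    simpa using hx
  have hconc : ConcaveOn ℝ (Set.Ioi 0) (fun x => U x - lam * L (-x)) := by
    refine ⟨convex_Ioi 0, fun x hx y hy a b ha hb hab => ?_⟩
    have h1 := hU.strictConcave.concaveOn.2 hx hy ha hb hab
    have h2 := hL.strictConvex.convexOn.2 (hneg hx) (hneg hy) ha hb hab
    simp only [smul_eq_mul] at h1 h2 ⊢
    rw [show a * -x + b * -y = -(a * x + b * y) by ring] at h2
    have h3 := mul_le_mul_of_nonneg_left h2 hlam
    linarith
  have hmono : StrictMonoOn (fun x => U x - lam * L (-x)) (Set.Ioi 0) := by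
    intro x hx y hy hxy
    have h1 := hU.strictMono hx hy hxy
    have h2 := hL.strictMono (hneg hy) (hneg hx) (neg_lt_neg hxy)
    have h3 := mul_le_mul_of_nonneg_left h2.le hlam
    dsimp only
    linarith
  have hderiv : ∀ x ∈ Set.Ioi (0 : ℝ),
      HasDerivAt (fun x => U x - lam * L (-x)) (U' x + lam * L' (-x)) x := fun x hx => by
    have h := (hU.hasDeriv x hx).sub
      (((hL.hasDeriv (-x) (hneg hx)).comp x (hasDerivAt_neg x)).const_mul lam)
    exact h.congr_deriv (by ring)
  have hbound := hconc.eventually_elasticity_le_half hmono hderiv hlim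
  calc _ ≤ (((1 / 2 : ℝ)) : EReal) := by
        refine Filter.limsup_le_of_le (h := ?_)
        filter_upwards [hbound] with x hx using EReal.coe_le_coe_iff.2 hx
    _ < 1 := by
        rw [← EReal.coe_one, EReal.coe_lt_coe_iff]
        norm_num
end

section
/- Let U be a utility function with lim_{x→∞} U(x) = +∞, let L be a loss function bounded below (i.e. lim_{x→−∞} L(x) > −∞), and let λ ≥ 0. Define W_λ(x) := U(x) − λ L(−x). Then limsup_{x→∞} x W_λ'(x)/W_λ(x) ≤ limsup_{x→∞} x U'(x)/U(x); in particular, if AE(U) < 1 then AE(W_λ) < 1. -/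
theorem ConcaveOn.mul_deriv_le_two_mul_sub {f : ℝ → ℝ} {f' x : ℝ}
    (hf : ConcaveOn ℝ (Set.Ioi 0) f) (hx : 0 < x) (hd : HasDerivAt f f' x) :
    x * f' ≤ 2 * (f x - f (x / 2)) := by
  have h := hf.le_slope_of_hasDerivAt (x := x / 2) (y := x) (by simpa using hx) hx
    (half_lt_self hx) hd
  rw [slope_def_field, le_div_iff₀ (by linarith)] at h
  linarith

theorem StrictMonoOn.nonneg_of_hasDerivAt {f : ℝ → ℝ} {f' x : ℝ} {s : Set ℝ}
    (hf : StrictMonoOn f s) (hs : s ∈ nhds x) (hd : HasDerivAt f f' x) : 0 ≤ f' := by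
  have hmono : MonotoneOn f s := hf.monotoneOn
  have hacc : AccPt x (Filter.principal s) := by
    rw [accPt_iff_frequently_nhdsNE]
    exact Filter.Eventually.frequently (mem_nhdsWithin_of_mem_nhds hs)
  exact hd.hasDerivWithinAt.nonneg_of_monotoneOn hacc hmono

theorem IsUtility.eventually_elasticity_mem_Icc {U U' : ℝ → ℝ} (hU : IsUtility U U')
    (hUlim : Filter.Tendsto U Filter.atTop Filter.atTop) :
    ∀ᶠ x in Filter.atTop, x * U' x / U x ∈ Set.Icc (0 : ℝ) 2 := by
  have hhalf : Filter.Tendsto (fun x : ℝ => x / 2) Filter.atTop Filter.atTop :=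
    Filter.tendsto_id.atTop_div_const (by norm_num)
  filter_upwards [Filter.eventually_gt_atTop 0, hUlim.eventually_gt_atTop 0,
    (hUlim.comp hhalf).eventually_ge_atTop 0] with x hx hUx hUx2
  have hd := hU.hasDeriv x hx
  have h1 := hU.strictConcave.concaveOn.mul_deriv_le_two_mul_sub hx hd
  have h2 := hU.strictMono.nonneg_of_hasDerivAt (Ioi_mem_nhds hx) hd
  simp only [Function.comp_apply] at hUx2
  exact ⟨by positivity, by rw [div_le_iff₀ hUx]; linarith⟩

theorem IsLoss.tendsto_mul_deriv_neg {L L' : ℝ → ℝ} (hL : IsLoss L L') {d : ℝ}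
    (hLlim : Filter.Tendsto L Filter.atBot (nhds d)) :
    Filter.Tendsto (fun x => x * L' (-x)) Filter.atTop (nhds 0) := by
  have hconc : ConcaveOn ℝ (Set.Ioi 0) (fun x => -L (-x)) := by
    have h := (hL.strictConvex.convexOn.comp_linearMap (-LinearMap.id)).neg
    have hset : (-LinearMap.id : ℝ →ₗ[ℝ] ℝ) ⁻¹' Set.Iio 0 = Set.Ioi 0 := by
      ext x
      simp
    rwa [hset] at h
  have hneg : Filter.Tendsto (fun x => L (-x)) Filter.atTop (nhds d) :=
    hLlim.comp Filter.tendsto_neg_atTop_atBot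
  have hhalf : Filter.Tendsto (fun x : ℝ => x / 2) Filter.atTop Filter.atTop :=
    Filter.tendsto_id.atTop_div_const (by norm_num)
  have hupper : Filter.Tendsto (fun x => 2 * (-L (-x) - -L (-(x / 2)))) Filter.atTop
      (nhds 0) := by
    simpa using (hneg.neg.sub (hneg.comp hhalf).neg).const_mul 2
  refine tendsto_of_tendsto_of_tendsto_of_le_of_le' tendsto_const_nhds hupper ?_ ?_
  · filter_upwards [Filter.eventually_gt_atTop 0] with x hx
    have hx' : -x < 0 := neg_lt_zero.2 hx
    exact mul_nonneg hx.le
      (hL.strictMono.nonneg_of_hasDerivAt (Iio_mem_nhds hx') (hL.hasDeriv _ hx'))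
  · filter_upwards [Filter.eventually_gt_atTop 0] with x hx
    refine hconc.mul_deriv_le_two_mul_sub hx ?_
    have hd := hL.hasDeriv (-x) (neg_lt_zero.2 hx)
    simpa [Function.comp_def] using! (hd.scomp x (hasDerivAt_neg x)).neg

theorem EReal.limsup_coe_add_le_of_tendsto_zero {α : Type*} {l : Filter α} {f e : α → ℝ}
    [l.NeBot] (he : Filter.Tendsto e l (nhds 0)) :
    Filter.limsup (fun x => ((f x + e x : ℝ) : EReal)) l
      ≤ Filter.limsup (fun x => (f x : EReal)) l := by
  have he' : Filter.limsup (fun x => (e x : EReal)) l = 0 :=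
    (EReal.tendsto_coe.2 he).limsup_eq
  calc _ ≤ Filter.limsup (fun x => (f x : EReal)) l + Filter.limsup (fun x => (e x : EReal)) l :=
        EReal.limsup_add_le (.inr (by simp [he'])) (.inr (by simp [he']))
    _ = _ := by rw [he', add_zero]

/-- If `U` tends to `+infinity` and `L` is bounded below, then the asymptotic elasticity of
`W_lam` is at most that of `U`; in particular `AE U < 1` implies `AE W_lam < 1`. -/
theorem ae_W_le_ae_U (U U' L L' : ℝ → ℝ) (hU : IsUtility U U') (hL : IsLoss L L')
    (hUlim : Filter.Tendsto U Filter.atTop Filter.atTop)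
    (dL : ℝ) (hLlim : Filter.Tendsto L Filter.atBot (nhds dL))
    (lam : ℝ) (hlam : 0 ≤ lam) :
    Filter.limsup
        (fun x : ℝ => ((x * (U' x + lam * L' (-x)) / (U x - lam * L (-x)) : ℝ) : EReal))
        Filter.atTop
      ≤ Filter.limsup (fun x : ℝ => ((x * U' x / U x : ℝ) : EReal)) Filter.atTop ∧
    (Filter.limsup (fun x : ℝ => ((x * U' x / U x : ℝ) : EReal)) Filter.atTop < 1 →
      Filter.limsup
        (fun x : ℝ => ((x * (U' x + lam * L' (-x)) / (U x - lam * L (-x)) : ℝ) : EReal))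
        Filter.atTop < 1) := by
  suffices h : _ from ⟨h, h.trans_lt⟩
  have hW : Filter.Tendsto (fun x => U x - lam * L (-x)) Filter.atTop Filter.atTop := by
    simpa only [sub_eq_add_neg, Function.comp_apply] using
      hUlim.atTop_add ((hLlim.comp Filter.tendsto_neg_atTop_atBot).const_mul lam).neg
  have hWinv := hW.inv_tendsto_atTop
  have hel := hU.eventually_elasticity_mem_Icc hUlim
  have hbdd : Filter.IsBoundedUnder (· ≤ ·) Filter.atTop
      (fun x => ‖x * U' x / U x‖) := by
    refine Filter.isBoundedUnder_of_eventually_le (a := 2) ?_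
    filter_upwards [hel] with x hx
    rw [Real.norm_of_nonneg hx.1]
    exact hx.2
  have hd : Filter.Tendsto (fun x => lam * L (-x)) Filter.atTop (nhds (lam * dL)) :=
    (hLlim.comp Filter.tendsto_neg_atTop_atBot).const_mul lam
  have hfirst : Filter.Tendsto
      (fun x => lam * (x * L' (-x)) * (U x - lam * L (-x))⁻¹) Filter.atTop (nhds 0) := by
    simpa using ((hL.tendsto_mul_deriv_neg hLlim).const_mul lam).mul hWinv
  have hsecond : Filter.Tendsto
      (fun x => lam * L (-x) * (U x - lam * L (-x))⁻¹ * (x * U' x / U x))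
      Filter.atTop (nhds 0) :=
    Filter.Tendsto.zero_mul_isBoundedUnder_le (by simpa using hd.mul hWinv) hbdd
  have herr := hfirst.add hsecond
  rw [add_zero] at herr
  refine le_of_eq_of_le (Filter.limsup_congr ?_)
    (EReal.limsup_coe_add_le_of_tendsto_zero (f := fun x => x * U' x / U x) herr)
  filter_upwards [hUlim.eventually_gt_atTop 0, hW.eventually_gt_atTop 0] with x hUx hWx
  congr 1
  field_simp
  ring
end

section
/- Let U be a utility function with lim_{x→∞} U(x) = +∞ and AE(U) := limsup_{x→∞} x U'(x)/U(x) < 1, let L be a loss function with lim_{x→−∞} L(x) = −∞ and AE₋(L) := limsup_{x→∞} (−x L'(−x))/L(−x) < 1, and let λ > 0. Define W_λ(x) := U(x) − λ L(−x). Then limsup_{x→∞} x W_λ'(x)/W_λ(x) ≤ max{AE(U), AE₋(L)} < 1. -/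
/-- A mediant of two fractions with positive denominators is at most their maximum. -/
theorem add_div_add_le_max_div {a b c d : ℝ} (hb : 0 < b) (hd : 0 < d) :
    (a + c) / (b + d) ≤ max (a / b) (c / d) := by
  rw [div_le_iff₀ (add_pos hb hd), mul_add]
  exact add_le_add ((div_le_iff₀ hb).1 (le_max_left _ _)) ((div_le_iff₀ hd).1 (le_max_right _ _))

/-- If `U → +infinity` with `AE U < 1` and `L → -infinity` with `AE₋ L < 1`, then
the asymptotic elasticity of `W_lam` is at most `max (AE U) (AE₋ L) < 1`. -/
theorem ae_W_le_max (U U' L L' : ℝ → ℝ) (hU : IsUtility U U') (hL : IsLoss L L')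
    (hUlim : Filter.Tendsto U Filter.atTop Filter.atTop)
    (hLlim : Filter.Tendsto L Filter.atBot Filter.atBot)
    (hAEU : Filter.limsup (fun x : ℝ => ((x * U' x / U x : ℝ) : EReal)) Filter.atTop < 1)
    (hAEL : Filter.limsup (fun x : ℝ => ((-x * L' (-x) / L (-x) : ℝ) : EReal))
      Filter.atTop < 1)
    (lam : ℝ) (hlam : 0 < lam) :
    Filter.limsup
        (fun x : ℝ => ((x * (U' x + lam * L' (-x)) / (U x - lam * L (-x)) : ℝ) : EReal))
        Filter.atTop
      ≤ max (Filter.limsup (fun x : ℝ => ((x * U' x / U x : ℝ) : EReal)) Filter.atTop)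
          (Filter.limsup (fun x : ℝ => ((-x * L' (-x) / L (-x) : ℝ) : EReal))
            Filter.atTop) ∧
    max (Filter.limsup (fun x : ℝ => ((x * U' x / U x : ℝ) : EReal)) Filter.atTop)
        (Filter.limsup (fun x : ℝ => ((-x * L' (-x) / L (-x) : ℝ) : EReal))
          Filter.atTop) < 1 := by
  refine ⟨?_, max_lt hAEU hAEL⟩
  rw [← limsup_max]
  refine Filter.limsup_le_limsup ?_
  filter_upwards [hUlim.eventually_gt_atTop 0,
    (hLlim.comp Filter.tendsto_neg_atTop_atBot).eventually_lt_atBot 0] with x hUx hLx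
  rw [Function.comp_apply] at hLx
  have hd : 0 < lam * -L (-x) := mul_pos hlam (neg_pos.2 hLx)
  have key := add_div_add_le_max_div (a := x * U' x) (c := lam * (x * L' (-x))) hUx hd
  have hsum : x * (U' x + lam * L' (-x)) / (U x - lam * L (-x)) =
      (x * U' x + lam * (x * L' (-x))) / (U x + lam * -L (-x)) := by
    congr 1 <;> ring
  have hquot : -x * L' (-x) / L (-x) = lam * (x * L' (-x)) / (lam * -L (-x)) := by
    rw [mul_div_mul_left _ _ hlam.ne', div_neg, neg_mul, neg_div]
  rw [hsum, hquot, ← EReal.coe_strictMono.monotone.map_max]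
  exact EReal.coe_le_coe_iff.2 key
end

section
/- Let U be a utility function with AE(U) := limsup_{x→∞} x U'(x)/U(x) < 1, let γ > 0 and λ > 0, and consider the exponential loss function L(x) = e^{γx} (so L(−x) = e^{−γx}). Then the asymptotic elasticity of W_λ(x) := U(x) − λ e^{−γx} is strictly less than one: limsup_{x→∞} x (U'(x) + λγ e^{−γx})/(U(x) − λ e^{−γx}) < 1 (the limsup taken in the extended reals). -/
theorem IsUtility.deriv_nonneg {U U' : ℝ → ℝ} (hU : IsUtility U U') {x : ℝ} (hx : 0 < x) :
    0 ≤ U' x := by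
  rw [← (hU.hasDeriv x hx).hasDerivWithinAt.derivWithin (isOpen_Ioi.uniqueDiffWithinAt hx)]
  exact hU.strictMono.monotoneOn.derivWithin_nonneg

theorem tendsto_mul_add_const_mul_exp_neg_mul {γ : ℝ} (hγ : 0 < γ) (a b : ℝ) :
    Filter.Tendsto (fun x : ℝ => (a * x + b) * Real.exp (-γ * x)) Filter.atTop (nhds 0) := by
  have hlin : Filter.Tendsto (fun x : ℝ => x * Real.exp (-γ * x)) Filter.atTop (nhds 0) := by
    simpa using tendsto_rpow_mul_exp_neg_mul_atTop_nhds_zero 1 γ hγ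
  have hexp : Filter.Tendsto (fun x : ℝ => Real.exp (-γ * x)) Filter.atTop (nhds 0) := by
    simpa using tendsto_rpow_mul_exp_neg_mul_atTop_nhds_zero 0 γ hγ
  have h := (hlin.const_mul a).add (hexp.const_mul b)
  simp only [mul_zero, add_zero] at h
  exact h.congr fun x => by ring

/-- For the exponential loss function `L x = exp (γ * x)` and any utility `U` with
`AE U < 1`, the asymptotic elasticity of `W_lam x = U x - lam * exp (-γ * x)` is strictly
less than one. -/
theorem ae_W_exponential_loss (U U' : ℝ → ℝ) (hU : IsUtility U U')
    (hAEU : Filter.limsup (fun x : ℝ => ((x * U' x / U x : ℝ) : EReal)) Filter.atTop < 1)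
    (γ lam : ℝ) (hγ : 0 < γ) (hlam : 0 < lam) :
    Filter.limsup
        (fun x : ℝ => ((x * (U' x + lam * γ * Real.exp (-γ * x)) /
          (U x - lam * Real.exp (-γ * x)) : ℝ) : EReal))
        Filter.atTop < 1 := by
  suffices h : ∃ d : ℝ, d < 1 ∧ ∀ᶠ x : ℝ in Filter.atTop,
      x * (U' x + lam * γ * Real.exp (-γ * x)) / (U x - lam * Real.exp (-γ * x)) ≤ d by
    obtain ⟨d, hd, hle⟩ := h
    refine lt_of_le_of_lt (Filter.limsup_le_of_le (a := (d : EReal)) (by isBoundedDefault) ?_)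
      (by exact_mod_cast hd)
    exact hle.mono fun x hx => by exact_mod_cast hx
  by_cases hpos : ∃ x₀ : ℝ, 0 < x₀ ∧ 0 < U x₀
  · obtain ⟨x₀, hx₀, hUx₀⟩ := hpos
    obtain ⟨c, hc, hc1⟩ := EReal.lt_iff_exists_real_btwn.1 hAEU
    have hc1' : c < 1 := by exact_mod_cast hc1
    refine ⟨(c + 1) / 2, by linarith, ?_⟩
    have hsmall := (tendsto_mul_add_const_mul_exp_neg_mul hγ (lam * γ)
      ((c + 1) / 2 * lam)).eventually_lt_const (u := (1 - c) / 2 * U x₀)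
      (mul_pos (by linarith) hUx₀)
    have hexp := (tendsto_mul_add_const_mul_exp_neg_mul hγ 0 lam).eventually_lt_const hUx₀
    filter_upwards [Filter.eventually_lt_of_limsup_lt hc, hsmall, hexp,
      Filter.eventually_ge_atTop x₀] with x hcx hs he hx
    have hmono : U x₀ ≤ U x := hU.strictMono.monotoneOn hx₀ (hx₀.trans_le hx) hx
    have hcx' : x * U' x / U x < c := by exact_mod_cast hcx
    rw [div_lt_iff₀ (hUx₀.trans_le hmono)] at hcx'
    rw [div_le_iff₀ (by linarith)]
    have := mul_le_mul_of_nonneg_left hmono (show 0 ≤ (1 - c) / 2 by linarith)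
    linarith
  · push Not at hpos
    refine ⟨0, zero_lt_one, ?_⟩
    filter_upwards [Filter.eventually_gt_atTop 0] with x hx
    have hU' := hU.deriv_nonneg hx
    have hexp := mul_pos hlam (Real.exp_pos (-γ * x))
    exact div_nonpos_of_nonneg_of_nonpos (by positivity) (by linarith [hpos x hx])
end
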